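/- arXiv:2208.13889 — 2 statements merged into one kernel-verified Lean document; each statement's English description precedes it below -/
import Mathlib

section
/- Let L be a tense DLI⁺-algebra with G⊥ = ⊥ and H⊥ = ⊥. Then the map θ ↦ γ_θ, where (a,b) γ_θ (x,y) iff (a,x) ∈ θ and (b,y) ∈ θ, is an order isomorphism (with respect to inclusion) from the lattice of congruences of L onto the lattice of congruences of K(L); its inverse is γ ↦ θ^γ, where (a,b) ∈ θ^γ iff (a,⊥) γ (b,⊥). -/
/-- A DLI-algebra: a bounded distributive lattice with an implication
satisfying (I1)-(I4). -/
structure DLI (A : Type*) [DistribLattice A] [BoundedOrder A] where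
  imp : A → A → A
  I1 : ∀ a b d : A, imp a b ⊓ imp a d = imp a (b ⊓ d)
  I2 : ∀ a b d : A, imp a d ⊓ imp b d = imp (a ⊔ b) d
  I3 : ∀ a : A, imp ⊥ a = ⊤
  I4 : ∀ a : A, imp a ⊤ = ⊤

/-- A tense DLI⁺-algebra: a DLI-algebra satisfying (I5), with tense operators
G, H, F, P satisfying (T1)-(T6). -/
structure TenseDLIp (A : Type*) [DistribLattice A] [BoundedOrder A] extends DLI A where
  I5 : ∀ a b : A, a ⊓ imp a b ≤ b
  G : A → A
  H : A → A
  F : A → A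
  P : A → A
  T1 : ∀ x y : A, P x ≤ y ↔ x ≤ G y
  T2 : ∀ x y : A, F x ≤ y ↔ x ≤ H y
  T3G : ∀ x y : A, G x ⊓ F y ≤ F (x ⊓ y)
  T3H : ∀ x y : A, H x ⊓ P y ≤ P (x ⊓ y)
  T4G : ∀ x y : A, G (x ⊔ y) ≤ G x ⊔ F y
  T4H : ∀ x y : A, H (x ⊔ y) ≤ H x ⊔ P y
  T5G : ∀ x y : A, G (imp x y) ≤ imp (G x) (G y)
  T5H : ∀ x y : A, H (imp x y) ≤ imp (H x) (H y)
  T6G : ∀ x y : A, G (imp x y) ≤ imp (F x) (F y)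
  T6H : ∀ x y : A, H (imp x y) ≤ imp (P x) (P y)

section Kalman

variable {A : Type*} [DistribLattice A] [BoundedOrder A]

/-- ∼(a,b) = (b,a) on the Kalman construction. -/
def negK (p : A × A) : A × A := (p.2, p.1)

/-- (a,b) ⊔ (x,y) = (a ⊔ x, b ⊓ y). -/
def supK (p q : A × A) : A × A := (p.1 ⊔ q.1, p.2 ⊓ q.2)

/-- (a,b) ⊓ (x,y) = (a ⊓ x, b ⊔ y). -/
def infK (p q : A × A) : A × A := (p.1 ⊓ q.1, p.2 ⊔ q.2)

/-- (a,b) ⇒ (x,y) = ((a→x) ⊓ (y→b), a ⊓ y). -/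
def impK (L : TenseDLIp A) (p q : A × A) : A × A :=
  (L.imp p.1 q.1 ⊓ L.imp q.2 p.2, p.1 ⊓ q.2)

/-- The order of the Kalman construction: (a,b) ≤ (x,y) iff a ≤ x and y ≤ b. -/
def leK (p q : A × A) : Prop := p.1 ≤ q.1 ∧ q.2 ≤ p.2

/-- G_K(a,b) = (G a, F b). -/
def GK (L : TenseDLIp A) (p : A × A) : A × A := (L.G p.1, L.F p.2)

/-- H_K(a,b) = (H a, P b). -/
def HK (L : TenseDLIp A) (p : A × A) : A × A := (L.H p.1, L.P p.2)

/-- F_K(a,b) = (F a, G b). -/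
def FK (L : TenseDLIp A) (p : A × A) : A × A := (L.F p.1, L.G p.2)

/-- P_K(a,b) = (P a, H b). -/
def PK (L : TenseDLIp A) (p : A × A) : A × A := (L.P p.1, L.H p.2)

end Kalman

section

variable {A : Type*} [DistribLattice A] [BoundedOrder A]

/-- Membership in the Kalman construction K(A). -/
def memK (p : A × A) : Prop := p.1 ⊓ p.2 = ⊥

/-- A congruence of a tense DLI⁺-algebra: an equivalence relation compatible
with ⊓, ⊔, →, G, H, F, P. -/
def IsCongr (L : TenseDLIp A) (θ : A → A → Prop) : Prop :=
  Equivalence θ ∧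
  (∀ a b x y : A, θ a b → θ x y →
    θ (a ⊓ x) (b ⊓ y) ∧ θ (a ⊔ x) (b ⊔ y) ∧ θ (L.imp a x) (L.imp b y)) ∧
  (∀ a b : A, θ a b →
    θ (L.G a) (L.G b) ∧ θ (L.H a) (L.H b) ∧ θ (L.F a) (L.F b) ∧ θ (L.P a) (L.P b))

/-- A congruence of the Kalman construction K(L): an equivalence relation on
K(A) compatible with ⊓, ⊔, ⇒, ∼, G_K, H_K. -/
def IsCongrK (L : TenseDLIp A) (γ : A × A → A × A → Prop) : Prop :=
  (∀ p : A × A, memK p → γ p p) ∧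
  (∀ p q : A × A, memK p → memK q → γ p q → γ q p) ∧
  (∀ p q r : A × A, memK p → memK q → memK r → γ p q → γ q r → γ p r) ∧
  (∀ p q r s : A × A, memK p → memK q → memK r → memK s → γ p q → γ r s →
    γ (infK p r) (infK q s) ∧ γ (supK p r) (supK q s) ∧
    γ (impK L p r) (impK L q s)) ∧
  (∀ p q : A × A, memK p → memK q → γ p q →
    γ (negK p) (negK q) ∧ γ (GK L p) (GK L q) ∧ γ (HK L p) (HK L q))

/-- The congruence γ_θ on K(A) induced by a congruence θ. -/
def gammaOf (θ : A → A → Prop) : A × A → A × A → Prop :=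
  fun p q => θ p.1 q.1 ∧ θ p.2 q.2

/-- The congruence θ^γ on A induced by a congruence γ of K(L). -/
def thetaOf (γ : A × A → A × A → Prop) : A → A → Prop :=
  fun a b => γ (a, ⊥) (b, ⊥)

end

section Kalman

variable {A : Type*} [DistribLattice A]

theorem infK_comm (p q : A × A) : infK p q = infK q p :=
  Prod.ext (inf_comm _ _) (sup_comm _ _)

theorem infK_supK_self (p q : A × A) : infK p (supK p q) = p :=
  Prod.ext inf_sup_self sup_inf_self

theorem infK_supK_left (p q r : A × A) :
    infK p (supK q r) = supK (infK p q) (infK p r) :=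
  Prod.ext (inf_sup_left _ _ _) (sup_inf_left _ _ _)

variable [BoundedOrder A]

theorem TenseDLIp.F_bot (L : TenseDLIp A) : L.F ⊥ = ⊥ :=
  le_bot_iff.mp ((L.T2 ⊥ ⊥).mpr bot_le)

theorem TenseDLIp.P_bot (L : TenseDLIp A) : L.P ⊥ = ⊥ :=
  le_bot_iff.mp ((L.T1 ⊥ ⊥).mpr bot_le)

theorem memK_mk_bot (a : A) : memK (a, (⊥ : A)) := inf_bot_eq a

theorem memK_bot_mk (a : A) : memK ((⊥ : A), a) := bot_inf_eq a

theorem memK_negK {p : A × A} (hp : memK p) : memK (negK p) :=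
  (inf_comm p.2 p.1).trans hp

theorem memK_infK {p q : A × A} (hp : memK p) (hq : memK q) : memK (infK p q) := by
  unfold memK infK at *
  rw [inf_sup_left, inf_right_comm, hp, inf_assoc, hq, bot_inf_eq, inf_bot_eq, bot_sup_eq]

theorem memK_supK {p q : A × A} (hp : memK p) (hq : memK q) : memK (supK p q) := by
  unfold memK supK at *
  rw [inf_sup_right, ← inf_assoc, hp, inf_left_comm, hq, bot_inf_eq, inf_bot_eq, bot_sup_eq]

theorem IsCongr.isCongrK_gammaOf {L : TenseDLIp A} {θ : A → A → Prop} (h : IsCongr L θ) :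
    IsCongrK L (gammaOf θ) := by
  obtain ⟨he, hb, hu⟩ := h
  refine ⟨fun p _ => ⟨he.refl _, he.refl _⟩, fun p q _ _ h => ⟨he.symm h.1, he.symm h.2⟩,
    fun p q r _ _ _ h k => ⟨he.trans h.1 k.1, he.trans h.2 k.2⟩, ?_, ?_⟩
  · rintro p q r s - - - - ⟨h₁, h₂⟩ ⟨k₁, k₂⟩
    exact ⟨⟨(hb _ _ _ _ h₁ k₁).1, (hb _ _ _ _ h₂ k₂).2.1⟩,
      ⟨(hb _ _ _ _ h₁ k₁).2.1, (hb _ _ _ _ h₂ k₂).1⟩,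
      ⟨(hb _ _ _ _ (hb _ _ _ _ h₁ k₁).2.2 (hb _ _ _ _ k₂ h₂).2.2).1, (hb _ _ _ _ h₁ k₂).1⟩⟩
  · rintro p q - - ⟨h₁, h₂⟩
    exact ⟨⟨h₂, h₁⟩, ⟨(hu _ _ h₁).1, (hu _ _ h₂).2.2.1⟩, ⟨(hu _ _ h₁).2.1, (hu _ _ h₂).2.2.2⟩⟩

theorem IsCongrK.isCongr_thetaOf {L : TenseDLIp A} (hG0 : L.G ⊥ = ⊥) (hH0 : L.H ⊥ = ⊥)
    {γ : A × A → A × A → Prop} (h : IsCongrK L γ) : IsCongr L (thetaOf γ) := by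
  obtain ⟨hr, hs, ht, hb, hu⟩ := h
  have m := memK_mk_bot (A := A)
  have m' := memK_bot_mk (A := A)
  refine ⟨⟨fun a => hr _ (m a), fun h => hs _ _ (m _) (m _) h,
    fun h k => ht _ _ _ (m _) (m _) (m _) h k⟩, ?_, ?_⟩
  · intro a b x y h k
    simpa [infK, supK, impK, L.I3, thetaOf] using hb _ _ _ _ (m a) (m b) (m x) (m y) h k
  · intro a b h
    obtain ⟨hn, hG, hH⟩ := hu _ _ (m a) (m b) h
    obtain ⟨-, hF, hP⟩ := hu _ _ (m' a) (m' b) hn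
    simp only [GK, HK, hG0, hH0, L.F_bot, L.P_bot] at hG hH hF hP
    exact ⟨hG, hH, (hu _ _ (m' _) (m' _) hF).1, (hu _ _ (m' _) (m' _) hP).1⟩

/-- A congruence of `K(L)` relates two elements as soon as it relates their joins and their meets
with a common element. -/
theorem IsCongrK.of_supK_of_infK {L : TenseDLIp A} {γ : A × A → A × A → Prop}
    (h : IsCongrK L γ) {p q c : A × A} (hp : memK p) (hq : memK q) (hc : memK c)
    (hsup : γ (supK p c) (supK q c)) (hinf : γ (infK p c) (infK q c)) : γ p q := by
  obtain ⟨hr, -, ht, hb, -⟩ := h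
  have hpc := memK_supK hp hc
  have hqc := memK_supK hq hc
  have h₁ := (hb _ _ _ _ hp hp hpc hqc (hr p hp) hsup).1
  have h₂ := (hb _ _ _ _ (memK_infK hp hq) (memK_infK hp hq) (memK_infK hp hc)
    (memK_infK hq hc) (hr _ (memK_infK hp hq)) hinf).2.1
  have h₃ := (hb _ _ _ _ hq hq hpc hqc (hr q hq) hsup).1
  rw [infK_supK_self, infK_supK_left] at h₁
  rw [infK_supK_self, infK_supK_left, infK_comm q p] at h₃
  have m₁ := memK_supK (memK_infK hp hq) (memK_infK hp hc)
  have m₂ := memK_supK (memK_infK hp hq) (memK_infK hq hc)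
  exact ht _ _ _ hp m₂ hq (ht _ _ _ hp m₁ m₂ h₁ h₂) h₃

theorem IsCongrK.gammaOf_thetaOf_iff {L : TenseDLIp A} {γ : A × A → A × A → Prop}
    (h : IsCongrK L γ) {p q : A × A} (hp : memK p) (hq : memK q) :
    gammaOf (thetaOf γ) p q ↔ γ p q := by
  have hc : memK ((⊥ : A), (⊥ : A)) := memK_mk_bot ⊥
  have hsup (r : A × A) : supK r (⊥, ⊥) = (r.1, ⊥) := by simp [supK]
  have hinf (r : A × A) : infK r (⊥, ⊥) = (⊥, r.2) := by simp [infK]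
  have key {r s : A × A} (hm : memK r) (hn : memK s) (hrs : γ r s) : γ (r.1, ⊥) (s.1, ⊥) := by
    simpa only [hsup] using (h.2.2.2.1 _ _ _ _ hm hn hc hc hrs (h.1 _ hc)).2.1
  constructor
  · rintro ⟨h₁, h₂⟩
    refine h.of_supK_of_infK hp hq hc ?_ ?_
    · rw [hsup, hsup]
      exact h₁
    · rw [hinf, hinf]
      exact (h.2.2.2.2 _ _ (memK_mk_bot _) (memK_mk_bot _) h₂).1
  · intro hpq
    exact ⟨key hp hq hpq, key (memK_negK hp) (memK_negK hq) (h.2.2.2.2 _ _ hp hq hpq).1⟩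

end Kalman

/-- The map θ ↦ γ_θ is an order isomorphism (w.r.t. inclusion) from the
congruences of L onto the congruences of K(L), with inverse γ ↦ θ^γ. -/
theorem stmt11 {A : Type*} [DistribLattice A] [BoundedOrder A] (L : TenseDLIp A)
    (hG0 : L.G ⊥ = ⊥) (hH0 : L.H ⊥ = ⊥) :
    (∀ θ : A → A → Prop, IsCongr L θ → IsCongrK L (gammaOf θ)) ∧
    (∀ γ : A × A → A × A → Prop, IsCongrK L γ → IsCongr L (thetaOf γ)) ∧
    (∀ θ : A → A → Prop, IsCongr L θ → thetaOf (gammaOf θ) = θ) ∧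
    (∀ γ : A × A → A × A → Prop, IsCongrK L γ →
      ∀ p q : A × A, memK p → memK q → (gammaOf (thetaOf γ) p q ↔ γ p q)) ∧
    (∀ θ₁ θ₂ : A → A → Prop, IsCongr L θ₁ → IsCongr L θ₂ →
      ((∀ a b : A, θ₁ a b → θ₂ a b) ↔
        (∀ p q : A × A, memK p → memK q → gammaOf θ₁ p q → gammaOf θ₂ p q))) := by
  refine ⟨fun θ h => h.isCongrK_gammaOf, fun γ h => h.isCongr_thetaOf hG0 hH0, fun θ h => ?_,
    fun γ h p q hp hq => h.gammaOf_thetaOf_iff hp hq, fun θ₁ θ₂ h₁ h₂ => ⟨?_, ?_⟩⟩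
  · funext a b
    exact propext ⟨fun k => k.1, fun k => ⟨k, h.1.refl ⊥⟩⟩
  · exact fun k p q _ _ hpq => ⟨k _ _ hpq.1, k _ _ hpq.2⟩
  · exact fun k a b hab =>
      (k (a, ⊥) (b, ⊥) (memK_mk_bot a) (memK_mk_bot b) ⟨hab, h₁.1.refl ⊥⟩).1
end

section
/- Let U = (T, G, H) be an itKI_c1-algebra and let S be a tense 1-filter of C(U). Then θ_S := {(u,v) ∈ T × T : u⇒(v⊔c) ∈ S, v⇒(u⊔c) ∈ S, ∼u⇒(∼v⊔c) ∈ S, and ∼v⇒(∼u⊔c) ∈ S} is a congruence of U (an equivalence relation compatible with ⊓, ⊔, ⇒, ∼, G, H). -/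
/-- A tense KI-algebra: a centered Kleene algebra with an implication ⇒
satisfying (KI1)-(KI5), together with tense operators G, H satisfying
(t1)-(t6), where F x := ∼G(∼x) and P x := ∼H(∼x). -/
structure TenseKI (T : Type*) [DistribLattice T] [BoundedOrder T] where
  neg : T → T
  c : T
  imp : T → T → T
  neg_neg : ∀ x : T, neg (neg x) = x
  neg_sup : ∀ x y : T, neg (x ⊔ y) = neg x ⊓ neg y
  kleene : ∀ x y : T, x ⊓ neg x ≤ y ⊔ neg y
  neg_c : neg c = c
  KI1a : ∀ x y z : T, imp x y ⊓ imp x z = imp x (y ⊓ z)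
  KI1b : ∀ x y z : T, imp x z ⊓ imp y z = imp (x ⊔ y) z
  KI1c : ∀ x : T, imp ⊥ x = ⊤
  KI1d : ∀ x : T, imp x ⊤ = ⊤
  KI2 : ∀ x y : T, (x ⊓ imp x y) ⊔ c ≤ y ⊔ c
  KI3 : imp c c = ⊤
  KI4 : ∀ x y : T, imp x y ⊓ c = (neg x ⊔ y) ⊓ c
  KI5 : ∀ x y : T, imp x (neg y) ⊔ c = imp x (neg y ⊔ c) ⊓ imp y (neg x ⊔ c)
  G : T → T
  H : T → T
  t1G : G ⊤ = ⊤
  t1H : H ⊤ = ⊤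
  t2G : ∀ x y : T, G (x ⊓ y) = G x ⊓ G y
  t2H : ∀ x y : T, H (x ⊓ y) = H x ⊓ H y
  t3G : ∀ x : T, x ≤ G (neg (H (neg x)))
  t3H : ∀ x : T, x ≤ H (neg (G (neg x)))
  t4G : ∀ x y : T, G (x ⊔ y) ≤ G x ⊔ neg (G (neg y))
  t4H : ∀ x y : T, H (x ⊔ y) ≤ H x ⊔ neg (H (neg y))
  t5G : ∀ x y : T, G (imp x y) ≤ imp (G x) (G y)
  t5H : ∀ x y : T, H (imp x y) ≤ imp (H x) (H y)
  t6G : ∀ x y : T, G (imp x y) ≤ imp (neg (G (neg x))) (neg (G (neg y)))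
  t6H : ∀ x y : T, H (imp x y) ≤ imp (neg (H (neg x))) (neg (H (neg y)))

/-- F x := ∼G(∼x). -/
def TenseKI.F {T : Type*} [DistribLattice T] [BoundedOrder T] (K : TenseKI T) (x : T) : T :=
  K.neg (K.G (K.neg x))

/-- P x := ∼H(∼x). -/
def TenseKI.P {T : Type*} [DistribLattice T] [BoundedOrder T] (K : TenseKI T) (x : T) : T :=
  K.neg (K.H (K.neg x))

/-- An itKI_c1-algebra: a tense centered KI-algebra satisfying x ⇒ x = ⊤
and the interpolation condition (CK). -/
structure ItKIc1 (T : Type*) [DistribLattice T] [BoundedOrder T] extends TenseKI T where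
  Gc : G c = c
  Hc : H c = c
  imp_self : ∀ x : T, imp x x = ⊤
  CK : ∀ x y : T, c ≤ x → c ≤ y → x ⊓ y ≤ c → ∃ z : T, z ⊔ c = x ∧ neg z ⊔ c = y

section
variable {T : Type*} [DistribLattice T] [BoundedOrder T]

/-- F on an itKI_c1-algebra. -/
abbrev ItKIc1.F (K : ItKIc1 T) : T → T := K.toTenseKI.F

/-- P on an itKI_c1-algebra. -/
abbrev ItKIc1.P (K : ItKIc1 T) : T → T := K.toTenseKI.P

/-- A congruence of an itKI_c1-algebra: an equivalence relation compatible
with ⊓, ⊔, ⇒, ∼, G, H. -/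
def ItKIc1.IsCongrU (K : ItKIc1 T) (ε : T → T → Prop) : Prop :=
  Equivalence ε ∧
  (∀ a b x y : T, ε a b → ε x y →
    ε (a ⊓ x) (b ⊓ y) ∧ ε (a ⊔ x) (b ⊔ y) ∧ ε (K.imp a x) (K.imp b y)) ∧
  (∀ a b : T, ε a b → ε (K.neg a) (K.neg b) ∧ ε (K.G a) (K.G b) ∧ ε (K.H a) (K.H b))

/-- A tense 1-filter of C(U): a lattice filter S of C(T) = {x : c ≤ x} with
((a⊓f)⇒b)⇒(a⇒b) ∈ S for all a, b ∈ C(T), f ∈ S, closed under G and H. -/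
def ItKIc1.IsTense1FilterC (K : ItKIc1 T) (S : Set T) : Prop :=
  (∀ x ∈ S, K.c ≤ x) ∧ S.Nonempty ∧
  (∀ x ∈ S, ∀ y : T, K.c ≤ y → x ≤ y → y ∈ S) ∧
  (∀ x ∈ S, ∀ y ∈ S, x ⊓ y ∈ S) ∧
  (∀ a b : T, K.c ≤ a → K.c ≤ b → ∀ f ∈ S,
    K.imp (K.imp (a ⊓ f) b) (K.imp a b) ∈ S) ∧
  (∀ x ∈ S, K.G x ∈ S) ∧ (∀ x ∈ S, K.H x ∈ S)

/-- A tense deductive system of U: contains ⊤, closed under modus ponens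
and under G and H. -/
def ItKIc1.IsTDS (K : ItKIc1 T) (D : Set T) : Prop :=
  ⊤ ∈ D ∧ (∀ u ∈ D, ∀ v : T, K.imp u v ∈ D → v ∈ D) ∧
  (∀ u ∈ D, K.G u ∈ D ∧ K.H u ∈ D)

/-- A centered tense deductive system: a tense deductive system D such that
(ctD1) D ∩ C(T) is a tense 1-filter of C(U) and (ctD2) ∼u⇒c ∈ D and
⊤⇒(u⊔c) ∈ D imply u ∈ D. -/
def ItKIc1.IsCTDS (K : ItKIc1 T) (D : Set T) : Prop :=
  K.IsTDS D ∧ K.IsTense1FilterC (D ∩ {x | K.c ≤ x}) ∧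
  (∀ u : T, K.imp (K.neg u) K.c ∈ D → K.imp ⊤ (u ⊔ K.c) ∈ D → u ∈ D)

end

namespace TenseKI

variable {T : Type*} [DistribLattice T] [BoundedOrder T] (K : TenseKI T)

lemma imp_mono_right (x : T) {y z : T} (h : y ≤ z) : K.imp x y ≤ K.imp x z := by
  have h₁ := K.KI1a x y z
  rw [inf_eq_left.2 h] at h₁
  exact inf_eq_left.1 h₁

lemma imp_anti_left {x y : T} (h : x ≤ y) (z : T) : K.imp y z ≤ K.imp x z := by
  have h₁ := K.KI1b x y z
  rw [sup_eq_right.2 h] at h₁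
  exact inf_eq_right.1 h₁

lemma neg_inf (x y : T) : K.neg (x ⊓ y) = K.neg x ⊔ K.neg y := by
  rw [← K.neg_neg (K.neg x ⊔ K.neg y), K.neg_sup, K.neg_neg, K.neg_neg]

lemma G_mono {x y : T} (h : x ≤ y) : K.G x ≤ K.G y := by
  have h₁ := K.t2G x y
  rw [inf_eq_left.2 h] at h₁
  exact inf_eq_left.1 h₁.symm

lemma H_mono {x y : T} (h : x ≤ y) : K.H x ≤ K.H y := by
  have h₁ := K.t2H x y
  rw [inf_eq_left.2 h] at h₁
  exact inf_eq_left.1 h₁.symm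

lemma c_le_imp (x : T) {y : T} (h : K.c ≤ y) : K.c ≤ K.imp x y := by
  have h₁ := K.KI4 x y
  rw [inf_eq_right.2 (h.trans le_sup_right)] at h₁
  exact inf_eq_right.1 h₁

lemma imp_sup_c_left (x : T) {y : T} (h : K.c ≤ y) : K.imp (x ⊔ K.c) y = K.imp x y := by
  have h₁ : K.imp K.c y = ⊤ := top_le_iff.1 (K.KI3 ▸ K.imp_mono_right K.c h)
  rw [← K.KI1b, h₁, inf_top_eq]

lemma imp_sup_c (x y : T) :
    K.imp x y ⊔ K.c = K.imp x (y ⊔ K.c) ⊓ K.imp (K.neg y) (K.neg x ⊔ K.c) := by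
  simpa only [K.neg_neg] using K.KI5 x (K.neg y)

lemma neg_imp_sup_c (x y : T) : K.neg (K.imp x y) ⊔ K.c = (x ⊓ K.neg y) ⊔ K.c := by
  have h := congrArg K.neg (K.KI4 x y)
  simpa only [K.neg_inf, K.neg_sup, K.neg_neg, K.neg_c] using h

/-- `u` lies below `v` modulo the set `S`, after joining with the center. -/
def LeMod (S : Set T) (u v : T) : Prop := ∃ f ∈ S, u ⊓ f ≤ v ⊔ K.c

end TenseKI

namespace ItKIc1.IsTense1FilterC

variable {T : Type*} [DistribLattice T] [BoundedOrder T] {K : ItKIc1 T} {S : Set T}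

lemma c_le (hS : K.IsTense1FilterC S) {x : T} (hx : x ∈ S) : K.c ≤ x := hS.1 x hx

lemma mem_of_le (hS : K.IsTense1FilterC S) {x y : T} (hx : x ∈ S) (h : x ≤ y) : y ∈ S :=
  hS.2.2.1 x hx y ((hS.c_le hx).trans h) h

lemma inf_mem (hS : K.IsTense1FilterC S) {x y : T} (hx : x ∈ S) (hy : y ∈ S) : x ⊓ y ∈ S :=
  hS.2.2.2.1 x hx y hy

lemma top_mem (hS : K.IsTense1FilterC S) : ⊤ ∈ S :=
  hS.2.1.elim fun _ hx => hS.mem_of_le hx le_top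

lemma G_mem (hS : K.IsTense1FilterC S) {x : T} (hx : x ∈ S) : K.G x ∈ S :=
  hS.2.2.2.2.2.1 x hx

lemma H_mem (hS : K.IsTense1FilterC S) {x : T} (hx : x ∈ S) : K.H x ∈ S :=
  hS.2.2.2.2.2.2 x hx

lemma mp (hS : K.IsTense1FilterC S) {x y : T} (hy : K.c ≤ y) (hx : x ∈ S)
    (h : K.imp x y ∈ S) : y ∈ S := by
  refine hS.mem_of_le (hS.inf_mem hx h) (le_sup_left.trans ((K.KI2 x y).trans ?_))
  rw [sup_eq_left.2 hy]

lemma imp_mem_iff (hS : K.IsTense1FilterC S) (u v : T) :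
    K.imp u (v ⊔ K.c) ∈ S ↔ K.LeMod S u v := by
  constructor
  · intro h
    refine ⟨_, h, le_sup_left.trans ((K.KI2 u (v ⊔ K.c)).trans ?_)⟩
    rw [sup_assoc, sup_idem]
  · rintro ⟨f, hf, h⟩
    rw [← K.imp_sup_c_left u le_sup_right]
    have hle : (u ⊔ K.c) ⊓ f ≤ v ⊔ K.c := by
      rw [inf_sup_right]
      exact sup_le h (inf_le_left.trans le_sup_right)
    have htop : K.imp ((u ⊔ K.c) ⊓ f) (v ⊔ K.c) = ⊤ :=
      top_le_iff.1 (K.imp_self (v ⊔ K.c) ▸ K.imp_anti_left hle (v ⊔ K.c))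
    have h₁ := hS.2.2.2.2.1 (u ⊔ K.c) (v ⊔ K.c) le_sup_right le_sup_right f hf
    rw [htop] at h₁
    exact hS.mp (K.c_le_imp _ le_sup_right) hS.top_mem h₁

lemma leMod_of_le (hS : K.IsTense1FilterC S) {u v : T} (h : u ≤ v ⊔ K.c) : K.LeMod S u v :=
  ⟨⊤, hS.top_mem, inf_le_left.trans h⟩

lemma leMod_trans (hS : K.IsTense1FilterC S) {u v w : T} (h : K.LeMod S u v)
    (h' : K.LeMod S v w) : K.LeMod S u w := by
  obtain ⟨f, hf, h⟩ := h
  obtain ⟨g, hg, h'⟩ := h'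
  refine ⟨f ⊓ g, hS.inf_mem hf hg, ?_⟩
  calc u ⊓ (f ⊓ g) = (u ⊓ f) ⊓ g := (inf_assoc _ _ _).symm
    _ ≤ (v ⊔ K.c) ⊓ g := inf_le_inf_right _ h
    _ = v ⊓ g ⊔ K.c ⊓ g := inf_sup_right _ _ _
    _ ≤ w ⊔ K.c := sup_le h' (inf_le_left.trans le_sup_right)

lemma leMod_inf (hS : K.IsTense1FilterC S) {u v w : T} (h : K.LeMod S u v)
    (h' : K.LeMod S u w) : K.LeMod S u (v ⊓ w) := by
  obtain ⟨f, hf, h⟩ := h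
  obtain ⟨g, hg, h'⟩ := h'
  refine ⟨f ⊓ g, hS.inf_mem hf hg, ?_⟩
  rw [sup_inf_right]
  exact le_inf ((inf_le_inf_left _ inf_le_left).trans h) ((inf_le_inf_left _ inf_le_right).trans h')

lemma leMod_sup (hS : K.IsTense1FilterC S) {u v w : T} (h : K.LeMod S u w)
    (h' : K.LeMod S v w) : K.LeMod S (u ⊔ v) w := by
  obtain ⟨f, hf, h⟩ := h
  obtain ⟨g, hg, h'⟩ := h'
  refine ⟨f ⊓ g, hS.inf_mem hf hg, ?_⟩
  rw [inf_sup_right]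
  exact sup_le ((inf_le_inf_left _ inf_le_left).trans h) ((inf_le_inf_left _ inf_le_right).trans h')

lemma leMod_inf_inf (hS : K.IsTense1FilterC S) {a b x y : T} (h : K.LeMod S a b)
    (h' : K.LeMod S x y) : K.LeMod S (a ⊓ x) (b ⊓ y) :=
  hS.leMod_inf (hS.leMod_trans (hS.leMod_of_le (inf_le_left.trans le_sup_left)) h)
    (hS.leMod_trans (hS.leMod_of_le (inf_le_right.trans le_sup_left)) h')

lemma leMod_sup_sup (hS : K.IsTense1FilterC S) {a b x y : T} (h : K.LeMod S a b)
    (h' : K.LeMod S x y) : K.LeMod S (a ⊔ x) (b ⊔ y) :=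
  hS.leMod_sup (hS.leMod_trans h (hS.leMod_of_le (le_sup_left.trans le_sup_left)))
    (hS.leMod_trans h' (hS.leMod_of_le (le_sup_right.trans le_sup_left)))

lemma leMod_congr (hS : K.IsTense1FilterC S) {u v u' v' : T} (hu : u ⊔ K.c = u' ⊔ K.c)
    (hv : v ⊔ K.c = v' ⊔ K.c) (h : K.LeMod S u' v') : K.LeMod S u v :=
  hS.leMod_trans (hS.leMod_of_le (hu ▸ le_sup_left))
    (hS.leMod_trans h (hS.leMod_of_le (hv.symm ▸ le_sup_left)))

lemma leMod_imp_sup_c (hS : K.IsTense1FilterC S) {a b x y : T} (h : K.LeMod S b a)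
    (h' : K.LeMod S x y) : K.LeMod S (K.imp a (x ⊔ K.c)) (K.imp b (y ⊔ K.c)) := by
  have hleft : K.LeMod S (K.imp a (x ⊔ K.c)) (K.imp b (x ⊔ K.c)) := by
    obtain ⟨f, hf, h⟩ := h
    have hle : (b ⊔ K.c) ⊓ f ≤ a ⊔ K.c := by
      rw [inf_sup_right]
      exact sup_le h (inf_le_left.trans le_sup_right)
    have h₁ := hS.2.2.2.2.1 (b ⊔ K.c) (x ⊔ K.c) le_sup_right le_sup_right f hf
    rw [← K.imp_sup_c_left a le_sup_right, ← K.imp_sup_c_left b le_sup_right]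
    refine hS.leMod_trans
      (hS.leMod_of_le ((K.imp_anti_left hle _).trans le_sup_left)) ((hS.imp_mem_iff _ _).1 ?_)
    rwa [sup_eq_left.2 (K.c_le_imp _ le_sup_right)]
  refine hS.leMod_trans hleft ?_
  obtain ⟨f, hf, h'⟩ := h'
  have hf' : K.imp b f ∈ S := by
    have h₁ := (hS.imp_mem_iff b f).2 ⟨f, hf, inf_le_right.trans le_sup_left⟩
    rwa [sup_eq_left.2 (hS.c_le hf)] at h₁
  refine ⟨_, hf', ?_⟩
  rw [K.KI1a]
  refine (K.imp_mono_right b ?_).trans le_sup_left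
  rw [inf_sup_right]
  exact sup_le h' (inf_le_left.trans le_sup_right)

lemma leMod_imp (hS : K.IsTense1FilterC S) {a b x y : T} (h : K.LeMod S b a)
    (h' : K.LeMod S x y) (hn : K.LeMod S (K.neg a) (K.neg b))
    (hn' : K.LeMod S (K.neg y) (K.neg x)) : K.LeMod S (K.imp a x) (K.imp b y) := by
  have key := hS.leMod_inf_inf (hS.leMod_imp_sup_c h h') (hS.leMod_imp_sup_c hn' hn)
  rw [← K.imp_sup_c, ← K.imp_sup_c] at key
  exact hS.leMod_congr (by rw [sup_assoc, sup_idem]) (by rw [sup_assoc, sup_idem]) key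

lemma leMod_neg_imp (hS : K.IsTense1FilterC S) {a b x y : T} (h : K.LeMod S a b)
    (hn : K.LeMod S (K.neg x) (K.neg y)) :
    K.LeMod S (K.neg (K.imp a x)) (K.neg (K.imp b y)) :=
  hS.leMod_congr (K.neg_imp_sup_c a x) (K.neg_imp_sup_c b y) (hS.leMod_inf_inf h hn)

lemma leMod_G (hS : K.IsTense1FilterC S) {a b : T} (h : K.LeMod S a b) :
    K.LeMod S (K.G a) (K.G b) := by
  obtain ⟨f, hf, h⟩ := h
  refine ⟨K.G f, hS.G_mem hf, ?_⟩
  have h₁ := K.t4G b K.c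
  rw [K.neg_c, K.Gc, K.neg_c] at h₁
  rw [← K.t2G]
  exact (K.G_mono h).trans h₁

lemma leMod_H (hS : K.IsTense1FilterC S) {a b : T} (h : K.LeMod S a b) :
    K.LeMod S (K.H a) (K.H b) := by
  obtain ⟨f, hf, h⟩ := h
  refine ⟨K.H f, hS.H_mem hf, ?_⟩
  have h₁ := K.t4H b K.c
  rw [K.neg_c, K.Hc, K.neg_c] at h₁
  rw [← K.t2H]
  exact (K.H_mono h).trans h₁

lemma leMod_neg_G (hS : K.IsTense1FilterC S) {a b : T}
    (h : K.LeMod S (K.neg a) (K.neg b)) : K.LeMod S (K.neg (K.G a)) (K.neg (K.G b)) := by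
  rw [← hS.imp_mem_iff] at h ⊢
  have h₁ := hS.mem_of_le (hS.G_mem h) (K.t6G _ _)
  simpa only [K.neg_sup, K.neg_neg, K.neg_c, K.t2G, K.Gc, K.neg_inf] using h₁

lemma leMod_neg_H (hS : K.IsTense1FilterC S) {a b : T}
    (h : K.LeMod S (K.neg a) (K.neg b)) : K.LeMod S (K.neg (K.H a)) (K.neg (K.H b)) := by
  rw [← hS.imp_mem_iff] at h ⊢
  have h₁ := hS.mem_of_le (hS.H_mem h) (K.t6H _ _)
  simpa only [K.neg_sup, K.neg_neg, K.neg_c, K.t2H, K.Hc, K.neg_inf] using h₁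

end ItKIc1.IsTense1FilterC

/-- If S is a tense 1-filter of C(U), then θ_S is a congruence of U. -/
theorem stmt13 {T : Type*} [DistribLattice T] [BoundedOrder T] (K : ItKIc1 T)
    (S : Set T) (hS : K.IsTense1FilterC S) :
    K.IsCongrU (fun u v =>
      K.imp u (v ⊔ K.c) ∈ S ∧ K.imp v (u ⊔ K.c) ∈ S ∧
      K.imp (K.neg u) (K.neg v ⊔ K.c) ∈ S ∧ K.imp (K.neg v) (K.neg u ⊔ K.c) ∈ S) := by
  simp only [hS.imp_mem_iff]
  refine ⟨⟨fun u => ?_, ?_, ?_⟩, ?_, ?_⟩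
  · have h (x : T) : K.LeMod S x x := hS.leMod_of_le le_sup_left
    exact ⟨h _, h _, h _, h _⟩
  · rintro u v ⟨h₁, h₂, h₃, h₄⟩
    exact ⟨h₂, h₁, h₄, h₃⟩
  · rintro u v w ⟨h₁, h₂, h₃, h₄⟩ ⟨k₁, k₂, k₃, k₄⟩
    exact ⟨hS.leMod_trans h₁ k₁, hS.leMod_trans k₂ h₂, hS.leMod_trans h₃ k₃,
      hS.leMod_trans k₄ h₄⟩
  · rintro a b x y ⟨h₁, h₂, h₃, h₄⟩ ⟨k₁, k₂, k₃, k₄⟩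
    refine ⟨?_, ?_, ?_⟩
    · simp only [K.neg_inf]
      exact ⟨hS.leMod_inf_inf h₁ k₁, hS.leMod_inf_inf h₂ k₂, hS.leMod_sup_sup h₃ k₃,
        hS.leMod_sup_sup h₄ k₄⟩
    · simp only [K.neg_sup]
      exact ⟨hS.leMod_sup_sup h₁ k₁, hS.leMod_sup_sup h₂ k₂, hS.leMod_inf_inf h₃ k₃,
        hS.leMod_inf_inf h₄ k₄⟩
    · exact ⟨hS.leMod_imp h₂ k₁ h₃ k₄, hS.leMod_imp h₁ k₂ h₄ k₃, hS.leMod_neg_imp h₁ k₃,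
        hS.leMod_neg_imp h₂ k₄⟩
  · rintro a b ⟨h₁, h₂, h₃, h₄⟩
    refine ⟨?_, ?_, ?_⟩
    · simp only [K.neg_neg]
      exact ⟨h₃, h₄, h₁, h₂⟩
    · exact ⟨hS.leMod_G h₁, hS.leMod_G h₂, hS.leMod_neg_G h₃, hS.leMod_neg_G h₄⟩
    · exact ⟨hS.leMod_H h₁, hS.leMod_H h₂, hS.leMod_neg_H h₃, hS.leMod_neg_H h₄⟩
end
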